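/- arXiv:2207.04238 — 2 statements merged into one kernel-verified Lean document; each statement's English description precedes it below -/
import Mathlib

section
/- Let G contain two vertex-disjoint clause gadgets with literal nodes l1,l2,l3 and l1',l2',l3' respectively, and a transfer node t whose neighbors in G are exactly the six literal nodes l1,l2,l3,l1',l2',l3'. Then in any pure Nash equilibrium of G for the Single-Neighbor pattern, t plays 0. -/
/-- `u` plays a best response under profile `s` for pattern `T` on graph `G`:
its strategy equals `T` applied to the number of its neighbors playing 1. -/
def BestResponds {V : Type*} [Fintype V] (G : SimpleGraph V) (T : ℕ → Bool)
    (s : V → Bool) (u : V) : Prop :=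
  s u = T (Set.ncard {w : V | G.Adj u w ∧ s w = true})

/-- `s` is a pure Nash equilibrium for pattern `T` on `G`. -/
def IsPNE {V : Type*} [Fintype V] (G : SimpleGraph V) (T : ℕ → Bool) (s : V → Bool) : Prop :=
  ∀ v : V, BestResponds G T s v

/-- `s` is a non-trivial pure Nash equilibrium for pattern `T` on `G`. -/
def IsNTPNE {V : Type*} [Fintype V] (G : SimpleGraph V) (T : ℕ → Bool) (s : V → Bool) : Prop :=
  IsPNE G T s ∧ ∃ v, s v = true

/-- The Single-Neighbor pattern: best response is 1 iff exactly one neighbor plays 1. -/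
def SN : ℕ → Bool := fun k => decide (k = 1)

/-- The At-Most-Single-Neighbor pattern: best response is 1 iff at most one neighbor plays 1. -/
def AMSN : ℕ → Bool := fun k => decide (k ≤ 1)

/-- A clause gadget in `G` on nine distinct vertices: literal nodes `l₁ l₂ l₃`,
inner nodes `a b c`, peripheral nodes `x y z`.  The exact neighborhoods of the
inner and peripheral nodes are specified (they have no neighbors outside the
gadget); the literal nodes are pairwise adjacent and may have further neighbors. -/
structure ClauseGadget {V : Type*} (G : SimpleGraph V)
    (l₁ l₂ l₃ a b c x y z : V) : Prop where
  distinct : [l₁, l₂, l₃, a, b, c, x, y, z].Pairwise (· ≠ ·)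
  adj_l₁l₂ : G.Adj l₁ l₂
  adj_l₁l₃ : G.Adj l₁ l₃
  adj_l₂l₃ : G.Adj l₂ l₃
  nbhd_a : G.neighborSet a = {b, c, l₁, x}
  nbhd_b : G.neighborSet b = {a, c, l₂, y}
  nbhd_c : G.neighborSet c = {a, b, l₃, z}
  nbhd_x : G.neighborSet x = {a, l₁, l₂, l₃}
  nbhd_y : G.neighborSet y = {b, l₁, l₂, l₃}
  nbhd_z : G.neighborSet z = {c, l₁, l₂, l₃}

theorem IsPNE.eq_true_iff_existsUnique {V : Type*} [Fintype V] {G : SimpleGraph V} {s : V → Bool}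
    (hs : IsPNE G SN s) (u : V) : s u = true ↔ ∃! w, G.Adj u w ∧ s w = true := by
  rw [hs u, SN, decide_eq_true_iff, Set.ncard_eq_one]
  simp only [Set.eq_singleton_iff_unique_mem, Set.mem_ofPred_eq, ExistsUnique]

/-- In an equilibrium for the Single-Neighbor pattern, two adjacent vertices `t` and `l` cannot
both play 1 if `l` has further neighbors `p` and `q` such that every neighbor of `p` other than `q`
is a neighbor of `t`. -/
theorem IsPNE.eq_false_of_adj {V : Type*} [Fintype V] {G : SimpleGraph V} {s : V → Bool}
    (hs : IsPNE G SN s) {t l p q : V} (htl : G.Adj t l) (hlp : G.Adj l p) (hlq : G.Adj l q)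
    (hpt : p ≠ t) (hqt : q ≠ t) (hp : ∀ w, G.Adj p w → w = q ∨ G.Adj t w) (ht : s t = true) :
    s l = false := by
  by_contra hl
  rw [Bool.not_eq_false] at hl
  have hl_unique {v w} := ((hs.eq_true_iff_existsUnique l).1 hl).unique (y₁ := v) (y₂ := w)
  have ht_unique {v w} := ((hs.eq_true_iff_existsUnique t).1 ht).unique (y₁ := v) (y₂ := w)
  have hsp : s p ≠ true := fun h ↦ hpt (hl_unique ⟨hlp, h⟩ ⟨htl.symm, ht⟩)
  have hsq : s q ≠ true := fun h ↦ hqt (hl_unique ⟨hlq, h⟩ ⟨htl.symm, ht⟩)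
  refine hsp ((hs.eq_true_iff_existsUnique p).2 ⟨l, ⟨hlp.symm, hl⟩, ?_⟩)
  rintro w ⟨hpw, hw⟩
  rcases hp w hpw with rfl | htw
  · exact absurd hw hsq
  · exact ht_unique ⟨htw, hw⟩ ⟨htl, hl⟩

/-- If `t` plays 1 in an equilibrium for the Single-Neighbor pattern and is adjacent to all literal
nodes of a clause gadget, then all these literal nodes play 0. -/
theorem ClauseGadget.literals_eq_false {V : Type*} [Fintype V] {G : SimpleGraph V}
    {l₁ l₂ l₃ a b c x y z t : V} (hg : ClauseGadget G l₁ l₂ l₃ a b c x y z)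
    (ht₁ : G.Adj t l₁) (ht₂ : G.Adj t l₂) (ht₃ : G.Adj t l₃)
    (hne : ∀ w ∈ [a, b, c, x, y, z], w ≠ t)
    {s : V → Bool} (hs : IsPNE G SN s) (ht : s t = true) :
    s l₁ = false ∧ s l₂ = false ∧ s l₃ = false := by
  have ha (w) : G.Adj a w ↔ w = b ∨ w = c ∨ w = l₁ ∨ w = x := Set.ext_iff.1 hg.nbhd_a w
  have hb (w) : G.Adj b w ↔ w = a ∨ w = c ∨ w = l₂ ∨ w = y := Set.ext_iff.1 hg.nbhd_b w
  have hc (w) : G.Adj c w ↔ w = a ∨ w = b ∨ w = l₃ ∨ w = z := Set.ext_iff.1 hg.nbhd_c w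
  have hx (w) : G.Adj x w ↔ w = a ∨ w = l₁ ∨ w = l₂ ∨ w = l₃ := Set.ext_iff.1 hg.nbhd_x w
  have hy (w) : G.Adj y w ↔ w = b ∨ w = l₁ ∨ w = l₂ ∨ w = l₃ := Set.ext_iff.1 hg.nbhd_y w
  have hz (w) : G.Adj z w ↔ w = c ∨ w = l₁ ∨ w = l₂ ∨ w = l₃ := Set.ext_iff.1 hg.nbhd_z w
  simp only [List.forall_mem_cons] at hne
  refine ⟨hs.eq_false_of_adj (p := x) (q := a) ht₁ ?_ ?_ ?_ ?_ ?_ ht,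
    hs.eq_false_of_adj (p := y) (q := b) ht₂ ?_ ?_ ?_ ?_ ?_ ht,
    hs.eq_false_of_adj (p := z) (q := c) ht₃ ?_ ?_ ?_ ?_ ?_ ht⟩ <;>
  grind [G.adj_comm]

/-- If `G` contains two vertex-disjoint clause gadgets and a transfer node `t`
whose neighbors are exactly the six literal nodes, then in any PNE for the
Single-Neighbor pattern, `t` plays 0. -/
theorem transferNode_plays_zero {V : Type*} [Fintype V] (G : SimpleGraph V)
    (l₁ l₂ l₃ a b c x y z l₁' l₂' l₃' a' b' c' x' y' z' t : V)
    (hg₁ : ClauseGadget G l₁ l₂ l₃ a b c x y z)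
    (hg₂ : ClauseGadget G l₁' l₂' l₃' a' b' c' x' y' z')
    (hdisj : [l₁, l₂, l₃, a, b, c, x, y, z,
      l₁', l₂', l₃', a', b', c', x', y', z', t].Pairwise (· ≠ ·))
    (ht : G.neighborSet t = {l₁, l₂, l₃, l₁', l₂', l₃'})
    (s : V → Bool) (hs : IsPNE G SN s) :
    s t = false := by
  have hadj (w) : G.Adj t w ↔ w = l₁ ∨ w = l₂ ∨ w = l₃ ∨ w = l₁' ∨ w = l₂' ∨ w = l₃' :=
    Set.ext_iff.1 ht w
  simp only [List.pairwise_cons, List.mem_cons] at hdisj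
  by_contra hst
  rw [Bool.not_eq_false] at hst
  have h₁ := hg₁.literals_eq_false (t := t) (by simp [hadj]) (by simp [hadj]) (by simp [hadj])
    (by grind) hs hst
  have h₂ := hg₂.literals_eq_false (t := t) (by simp [hadj]) (by simp [hadj]) (by simp [hadj])
    (by grind) hs hst
  obtain ⟨w, ⟨hw, hsw⟩, -⟩ := (hs.eq_true_iff_existsUnique t).1 hst
  rcases (hadj w).1 hw with rfl | rfl | rfl | rfl | rfl | rfl <;> simp_all
end

section
/- Let G contain two vertex-disjoint clause gadgets, let l and l' be literal nodes of these two gadgets respectively, and let k be a copy node whose neighbors in G are exactly l and l'. Then in any pure Nash equilibrium of G for the Single-Neighbor pattern, k plays 0 and l and l' play the same value, i.e. s(l) = s(l'). -/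
theorem IsPNE.eq_true_iff {V : Type*} [Fintype V] {G : SimpleGraph V} {s : V → Bool}
    (hs : IsPNE G SN s) (v : V) :
    s v = true ↔ ∃ w, (G.Adj v w ∧ s w = true) ∧ ∀ u, G.Adj v u → s u = true → u = w := by
  have h : s v = decide _ := hs v
  rw [h, decide_eq_true_iff, Set.ncard_eq_one]
  simp only [Set.eq_singleton_iff_unique_mem, Set.mem_ofPred_eq, and_imp]

namespace ClauseGadget

variable {V : Type*} {G : SimpleGraph V} {l₁ l₂ l₃ a b c x y z : V}

/-- A clause gadget is invariant under cyclic rotation of its three branches. -/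
theorem rotate (hg : ClauseGadget G l₁ l₂ l₃ a b c x y z) :
    ClauseGadget G l₂ l₃ l₁ b c a y z x where
  distinct := by
    have := hg.distinct
    simp only [List.pairwise_cons, List.mem_cons, List.not_mem_nil, or_false] at this ⊢
    grind
  adj_l₁l₂ := hg.adj_l₂l₃
  adj_l₁l₃ := hg.adj_l₁l₂.symm
  adj_l₂l₃ := hg.adj_l₁l₃.symm
  nbhd_a := by rw [hg.nbhd_b]; grind
  nbhd_b := by rw [hg.nbhd_c]; grind
  nbhd_c := hg.nbhd_a
  nbhd_x := by rw [hg.nbhd_y]; grind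
  nbhd_y := by rw [hg.nbhd_z]; grind
  nbhd_z := by rw [hg.nbhd_x]; grind

/-- In a PNE, a literal node playing 1 forces its paired peripheral node to play 1. -/
theorem peripheral_eq_true [Fintype V] (hg : ClauseGadget G l₁ l₂ l₃ a b c x y z)
    {s : V → Bool} (hs : IsPNE G SN s) (h₁ : s l₁ = true) : s x = true := by
  have hd := hg.distinct
  simp only [List.pairwise_cons, List.mem_cons, List.not_mem_nil, or_false] at hd
  have na (w) : G.Adj a w ↔ w = b ∨ w = c ∨ w = l₁ ∨ w = x := Set.ext_iff.mp hg.nbhd_a w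
  have nb (w) : G.Adj b w ↔ w = a ∨ w = c ∨ w = l₂ ∨ w = y := Set.ext_iff.mp hg.nbhd_b w
  have nc (w) : G.Adj c w ↔ w = a ∨ w = b ∨ w = l₃ ∨ w = z := Set.ext_iff.mp hg.nbhd_c w
  have nx (w) : G.Adj x w ↔ w = a ∨ w = l₁ ∨ w = l₂ ∨ w = l₃ := Set.ext_iff.mp hg.nbhd_x w
  have ny (w) : G.Adj y w ↔ w = b ∨ w = l₁ ∨ w = l₂ ∨ w = l₃ := Set.ext_iff.mp hg.nbhd_y w
  have nz (w) : G.Adj z w ↔ w = c ∨ w = l₁ ∨ w = l₂ ∨ w = l₃ := Set.ext_iff.mp hg.nbhd_z w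
  have ba := hs.eq_true_iff a
  have bb := hs.eq_true_iff b
  have bc := hs.eq_true_iff c
  have bx := hs.eq_true_iff x
  have bY := hs.eq_true_iff y
  have bz := hs.eq_true_iff z
  simp only [na, nb, nc, nx, ny, nz, or_and_right, exists_or, exists_eq_left, and_assoc, or_imp,
    forall_and, forall_eq] at ba bb bc bx bY bz
  obtain ⟨w, -, hw⟩ := (hs.eq_true_iff l₁).mp h₁
  have w₂ := hw l₂ hg.adj_l₁l₂
  have w₃ := hw l₃ hg.adj_l₁l₃
  have wa := hw a ((na l₁).mpr (by simp)).symm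
  have wx := hw x ((nx l₁).mpr (by simp)).symm
  have wy := hw y ((ny l₁).mpr (by simp)).symm
  have wz := hw z ((nz l₁).mpr (by simp)).symm
  clear hw na nb nc nx ny nz hs hg
  grind

/-- In a PNE, the only neighbor playing 1 of a literal node playing 1 is a peripheral node. -/
theorem mem_peripheral_of_adj [Fintype V] (hg : ClauseGadget G l₁ l₂ l₃ a b c x y z)
    {s : V → Bool} (hs : IsPNE G SN s) {l k : V} (hl : l ∈ ({l₁, l₂, l₃} : Set V))
    (hsl : s l = true) (hlk : G.Adj l k) (hsk : s k = true) : k ∈ ({x, y, z} : Set V) := by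
  have key {m p : V} (hm : s m = true) (hp : s p = true) (hmp : G.Adj p m) (hmk : G.Adj m k) :
      k = p := by
    obtain ⟨w, -, hw⟩ := (hs.eq_true_iff m).mp hm
    rw [hw k hmk hsk, hw p hmp.symm hp]
  have adj {p q m₁ m₂ m₃ : V} (h : G.neighborSet p = {q, m₁, m₂, m₃}) (m : V)
      (hm : m ∈ ({q, m₁, m₂, m₃} : Set V)) : G.Adj p m := by
    rwa [← h] at hm
  rcases hl with rfl | rfl | rfl
  · exact .inl (key hsl (hg.peripheral_eq_true hs hsl) (adj hg.nbhd_x _ (by simp)) hlk)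
  · exact .inr (.inl
      (key hsl (hg.rotate.peripheral_eq_true hs hsl) (adj hg.nbhd_y _ (by simp)) hlk))
  · exact .inr (.inr
      (key hsl (hg.rotate.rotate.peripheral_eq_true hs hsl) (adj hg.nbhd_z _ (by simp)) hlk))

end ClauseGadget

/-- If `G` contains two vertex-disjoint clause gadgets, `l` and `l'` are literal
nodes of the two gadgets respectively, and `k` is a copy node whose neighbors are
exactly `l` and `l'`, then in any PNE for the Single-Neighbor pattern, `k` plays 0
and `l`, `l'` play the same value. -/
theorem copyNode_copies {V : Type*} [Fintype V] (G : SimpleGraph V)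
    (l₁ l₂ l₃ a b c x y z l₁' l₂' l₃' a' b' c' x' y' z' l l' k : V)
    (hg₁ : ClauseGadget G l₁ l₂ l₃ a b c x y z)
    (hg₂ : ClauseGadget G l₁' l₂' l₃' a' b' c' x' y' z')
    (hdisj : [l₁, l₂, l₃, a, b, c, x, y, z,
      l₁', l₂', l₃', a', b', c', x', y', z', k].Pairwise (· ≠ ·))
    (hl : l ∈ ({l₁, l₂, l₃} : Set V)) (hl' : l' ∈ ({l₁', l₂', l₃'} : Set V))
    (hk : G.neighborSet k = {l, l'})
    (s : V → Bool) (hs : IsPNE G SN s) :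
    s k = false ∧ s l = s l' := by
  have hd : k ∉ ({x, y, z} : Set V) ∧ k ∉ ({x', y', z'} : Set V) := by
    simp only [List.pairwise_cons, List.mem_cons, List.not_mem_nil, or_false] at hdisj
    simp only [Set.mem_insert_iff, Set.mem_singleton_iff]
    grind
  have nk (w) : G.Adj k w ↔ w = l ∨ w = l' := Set.ext_iff.mp hk w
  have hlk : s k = true → s l ≠ true := fun hsk hsl ↦
    hd.1 (hg₁.mem_peripheral_of_adj hs hl hsl ((nk l).mpr (.inl rfl)).symm hsk)
  have hlk' : s k = true → s l' ≠ true := fun hsk hsl ↦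
    hd.2 (hg₂.mem_peripheral_of_adj hs hl' hsl ((nk l').mpr (.inr rfl)).symm hsk)
  have bk := hs.eq_true_iff k
  simp only [nk, or_and_right, exists_or, exists_eq_left, and_assoc, or_imp, forall_and,
    forall_eq] at bk
  grind
end
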